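/- Let ν be a good measure sequence on ℤ (with dual group 𝕋) or on ℝ (self-dual) that goes to infinity. Then the subgroup Γ_ν = { g : |c_ν(g)| = 1 } of the dual group (𝕋 or ℝ respectively) is discrete, i.e. not dense. -/

import Mathlib

open MeasureTheory Filter Topology Real

namespace GammaNu

lemma norm_e (s t : ℝ) : ‖Complex.exp (-(2 * π * Complex.I * s * t))‖ = 1 := by
  have : -(2 * π * Complex.I * s * t) = ((-(2 * π * s * t) : ℝ) : ℂ) * Complex.I := by
    push_cast; ring
  rw [this, Complex.norm_exp_ofReal_mul_I]

lemma tendsto_zero_of_infty (ν : ℕ → Measure ℝ) (hν : ∀ N, IsProbabilityMeasure (ν N))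
    (hinf : ∀ K : Set ℝ, IsCompact K → Tendsto (fun N => ν N K) atTop (𝓝 0))
    (g : ℝ → ℂ) (B : ℝ) (hB : ∀ t, ‖g t‖ ≤ B)
    (hg : Tendsto g (cocompact ℝ) (𝓝 0)) (ε : ℝ) (hε : 0 < ε) :
    ∃ M, ∀ N ≥ M, ‖∫ t, g t ∂ν N‖ ≤ ε := by
  have h1 : ∀ᶠ t in cocompact ℝ, ‖g t‖ < ε / 2 := by
    have := (tendsto_zero_iff_norm_tendsto_zero.1 hg)
    exact this.eventually (gt_mem_nhds (half_pos hε))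
  obtain ⟨K, hK, hKs⟩ := mem_cocompact.1 h1
  have h2 : Tendsto (fun N => B * (ν N).real K) atTop (𝓝 0) := by
    have := (ENNReal.tendsto_toReal ENNReal.zero_ne_top).comp (hinf K hK)
    simpa [Measure.real, Function.comp_def] using this.const_mul B
  obtain ⟨M, hM⟩ := eventually_atTop.1 (h2.eventually (gt_mem_nhds (half_pos hε)))
  refine ⟨M, fun N hN => ?_⟩
  have hB0 : 0 ≤ B := (norm_nonneg _).trans (hB 0)
  have := hν N
  have hi : Integrable (K.indicator fun _ => B) (ν N) :=
    (integrable_const B).indicator hK.measurableSet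
  have h3 : ‖∫ t, g t ∂ν N‖ ≤ ∫ t, (ε / 2 + K.indicator (fun _ => B) t) ∂ν N := by
    refine norm_integral_le_of_norm_le ((integrable_const _).add hi) (ae_of_all _ fun t => ?_)
    by_cases ht : t ∈ K
    · simp only [Set.indicator_of_mem ht]
      linarith [hB t]
    · simp only [Set.indicator_of_notMem ht]
      have : ‖g t‖ < ε / 2 := hKs ht
      linarith
  rw [integral_add (integrable_const _) hi, integral_indicator_const _ hK.measurableSet] at h3
  have := hM N hN
  simp only [integral_const, probReal_univ, smul_eq_mul, one_mul] at h3
  linarith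

lemma real_case (ν : ℕ → Measure ℝ) (hν : ∀ N, IsProbabilityMeasure (ν N))
    (c : ℝ → ℂ)
    (hc : ∀ s : ℝ, Tendsto
        (fun N => ∫ t : ℝ, Complex.exp (-(2 * π * Complex.I * s * t)) ∂ν N)
        atTop (𝓝 (c s)))
    (hinf : ∀ K : Set ℝ, IsCompact K → Tendsto (fun N => ν N K) atTop (𝓝 0)) :
    ¬ Dense {s : ℝ | ‖c s‖ = 1} := by
  intro hD
  set f : ℕ → ℝ → ℂ := fun N s => ∫ t : ℝ, Complex.exp (-(2 * π * Complex.I * s * t)) ∂ν N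
    with hf
  have hfc : ∀ N, Continuous (f N) := by
    intro N
    have := hν N
    refine continuous_of_dominated (bound := fun _ => 1) ?_ ?_ (integrable_const _) ?_
    · intro s
      exact Continuous.aestronglyMeasurable (by fun_prop)
    · intro s
      exact ae_of_all _ fun t => (norm_e s t).le
    · exact ae_of_all _ fun t => by fun_prop
  let E : ℕ → Set ℝ := fun M => ⋂ N, ⋂ (_ : M ≤ N), {s | ‖f N s - f M s‖ ≤ 1 / 4}
  have hE : ∀ M, IsClosed (E M) := fun M =>
    isClosed_iInter fun N => isClosed_iInter fun _ =>
      isClosed_le (((hfc N).sub (hfc M)).norm) continuous_const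
  have hU : ⋃ M, E M = Set.univ := by
    refine Set.eq_univ_of_forall fun s => ?_
    obtain ⟨M, hM⟩ := Metric.cauchySeq_iff'.1 (hc s).cauchySeq (1 / 4) (by norm_num)
    refine Set.mem_iUnion.2 ⟨M, ?_⟩
    simp only [E, Set.mem_iInter]
    intro N hN
    have := hM N hN
    rw [dist_eq_norm] at this
    exact this.le
  obtain ⟨M, hMne⟩ := nonempty_interior_of_iUnion_of_closed hE hU
  obtain ⟨s₀, hs₀, hs₀c⟩ := hD.inter_open_nonempty _ isOpen_interior hMne
  have hs₀c : ‖c s₀‖ = 1 := hs₀c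
  have hEM : ∀ s ∈ interior (E M), ∀ N ≥ M, ‖f N s - f M s‖ ≤ 1 / 4 := by
    intro s hs N hN
    have := interior_subset hs
    simp only [E, Set.mem_iInter] at this
    exact this N hN
  have hcM : ‖c s₀ - f M s₀‖ ≤ 1 / 4 := by
    refine le_of_tendsto ((hc s₀).sub_const (f M s₀)).norm ?_
    filter_upwards [eventually_ge_atTop M] with N hN using hEM s₀ hs₀ N hN
  have hnear : ∀ᶠ s in 𝓝 s₀, s ∈ interior (E M) ∧ ‖f M s - f M s₀‖ < 1 / 4 := by
    refine Eventually.and (isOpen_interior.mem_nhds hs₀) ?_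
    have := Metric.tendsto_nhds.1 ((hfc M).tendsto s₀) (1 / 4) (by norm_num)
    simpa only [dist_eq_norm] using this
  obtain ⟨δ, hδ, hball⟩ := Metric.nhds_basis_closedBall.eventually_iff.1 hnear
  set I : Set ℝ := Metric.closedBall s₀ δ with hI
  have hIm : MeasurableSet I := measurableSet_closedBall
  have hIc : IsCompact I := isCompact_closedBall _ _
  have hIv : volume.real I = 2 * δ := Real.volume_real_closedBall hδ.le
  have : IsFiniteMeasure (volume.restrict I) := ⟨by simpa using hIc.measure_lt_top⟩
  have hclose : ∀ N ≥ M, ∀ s ∈ I, ‖f N s - c s₀‖ ≤ 3 / 4 := by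
    intro N hN s hs
    obtain ⟨h1, h2⟩ := hball hs
    have h3 := hEM s h1 N hN
    have e : f N s - c s₀ = (f N s - f M s) + (f M s - f M s₀) - (c s₀ - f M s₀) := by ring
    rw [e]
    have := norm_sub_le ((f N s - f M s) + (f M s - f M s₀)) (c s₀ - f M s₀)
    have := norm_add_le (f N s - f M s) (f M s - f M s₀)
    linarith
  let g : ℝ → ℂ := fun t => ∫ s in I, Complex.exp (-(2 * π * Complex.I * s * t))
  have hgB : ∀ t, ‖g t‖ ≤ 1 * volume.real I := fun t =>
    norm_setIntegral_le_of_norm_le_const hIc.measure_lt_top fun s _ => (norm_e s t).le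
  have hg0 : Tendsto g (cocompact ℝ) (𝓝 0) := by
    have h := Real.tendsto_integral_exp_smul_cocompact (I.indicator fun _ => (1 : ℂ))
    refine h.congr fun t => ?_
    simp only [g]
    rw [← integral_indicator hIm]
    refine integral_congr_ae (ae_of_all _ fun s => ?_)
    by_cases hs : s ∈ I
    · simp only [Set.indicator_of_mem hs, Circle.smul_def, Real.fourierChar_apply, smul_eq_mul,
        mul_one]
      congr 1
      push_cast
      ring
    · simp [Set.indicator_of_notMem hs]
  obtain ⟨M', hM'⟩ := tendsto_zero_of_infty ν hν hinf g _ hgB hg0 (δ / 4) (by positivity)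
  set N := max M M'
  have hN1 : M ≤ N := le_max_left _ _
  have hN2 := hM' N (le_max_right _ _)
  have := hν N
  have hswap : ∫ t, g t ∂ν N = ∫ s in I, f N s := by
    simp only [g, hf]
    refine integral_integral_swap
      (f := fun t s : ℝ => Complex.exp (-(2 * π * Complex.I * s * t))) ?_
    refine Integrable.of_bound (C := 1) ?_ (ae_of_all _ fun p => (norm_e p.2 p.1).le)
    refine Continuous.aestronglyMeasurable ?_
    unfold Function.uncurry
    fun_prop
  rw [hswap] at hN2
  have h4 : ‖∫ s in I, (f N s - c s₀)‖ ≤ 3 / 4 * volume.real I :=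
    norm_setIntegral_le_of_norm_le_const hIc.measure_lt_top (hclose N hN1)
  rw [integral_sub ((hfc N).continuousOn.integrableOn_compact hIc) (integrable_const _),
    setIntegral_const, hIv] at h4
  have h5 : ‖(2 * δ) • c s₀‖ = 2 * δ := by
    rw [norm_smul, hs₀c, Real.norm_of_nonneg (by positivity), mul_one]
  have h6 := norm_sub_norm_le ((2 * δ) • c s₀) (∫ s in I, f N s)
  rw [norm_sub_rev, h5] at h6
  linarith

end GammaNu

/-- For a good measure sequence going to infinity on `H = ℤ` (with dual group `𝕋`,
pairing `⟨λ,n⟩ = λ^{-n}`) or on `H = ℝ` (self-dual, pairing `⟨r,s⟩ = e^{-2πirs}`),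
the subgroup `Γ_ν = {g : |c_ν(g)| = 1}` of the dual group is not dense (it is discrete,
since subgroups of `𝕋` and `ℝ` are either discrete or dense). -/
theorem gamma_nu_not_dense :
    (∀ (ν : ℕ → Measure ℤ), (∀ N, IsProbabilityMeasure (ν N)) →
      ∀ c : Circle → ℂ,
      (∀ lam : Circle, Tendsto (fun N => ∫ n : ℤ, ((lam ^ (-n) : Circle) : ℂ) ∂ν N)
        atTop (𝓝 (c lam))) →
      (∀ K : Set ℤ, IsCompact K → Tendsto (fun N => ν N K) atTop (𝓝 0)) →
      ¬ Dense {lam : Circle | ‖c lam‖ = 1}) ∧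
    (∀ (ν : ℕ → Measure ℝ), (∀ N, IsProbabilityMeasure (ν N)) →
      ∀ c : ℝ → ℂ,
      (∀ s : ℝ, Tendsto
        (fun N => ∫ t : ℝ, Complex.exp (-(2 * π * Complex.I * s * t)) ∂ν N)
        atTop (𝓝 (c s))) →
      (∀ K : Set ℝ, IsCompact K → Tendsto (fun N => ν N K) atTop (𝓝 0)) →
      ¬ Dense {s : ℝ | ‖c s‖ = 1}) := by

  refine ⟨?_, GammaNu.real_case⟩
  intro ν hν c hc hinf hD
  have hm : Measurable (fun n : ℤ => (n : ℝ)) := measurable_from_top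
  refine GammaNu.real_case (fun N => (ν N).map (fun n : ℤ => (n : ℝ)))
    (fun N => have := hν N; Measure.isProbabilityMeasure_map hm.aemeasurable)
    (fun s => c (Real.fourierChar s)) ?_ ?_ ?_
  · intro s
    refine (hc (Real.fourierChar s)).congr fun N => ?_
    rw [integral_map hm.aemeasurable (Continuous.aestronglyMeasurable (by fun_prop))]
    refine integral_congr_ae (ae_of_all _ fun n => ?_)
    simp only [Circle.coe_zpow, Real.fourierChar_apply]
    rw [← Complex.exp_int_mul]
    congr 1
    push_cast
    ring
  · intro K hK
    have hK' : IsCompact ((fun n : ℤ => (n : ℝ)) ⁻¹' K) :=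
      Int.isClosedEmbedding_coe_real.isCompact_preimage hK
    refine (hinf _ hK').congr fun N => ?_
    rw [Measure.map_apply hm hK.measurableSet]
  · have hop : IsOpenMap (fun s : ℝ => Real.fourierChar s) := by
      have h := (isLocalHomeomorph_circleExp).isOpenMap.comp
        (Homeomorph.mulLeft₀ (2 * π) (by positivity)).isOpenMap
      exact h
    exact hD.preimage hop
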